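/- arXiv:1512.00419 — 2 statements merged into one kernel-verified Lean document; each statement's English description precedes it below -/
import Mathlib

section
/- (Upper bound on violations for three-player XOR games in terms of the number of questions.) There exists a universal constant C > 0 such that for all integers n₁, n₂, n₃ ≥ 1 and every real tensor Ĝ ∈ ℝ^{n₁×n₂×n₃}, the entangled bias satisfies β*(Ĝ) ≤ C · √(min(n₁, n₂, n₃)) · β(Ĝ). -/
/-- A matrix has operator norm (on `ℓ₂`) at most one. -/
def IsContraction {d : ℕ} (A : Matrix (Fin d) (Fin d) ℂ) : Prop :=
  ∀ v : Fin d → ℂ,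
    ∑ i, ‖A.mulVec v i‖ ^ 2 ≤ ∑ i, ‖v i‖ ^ 2

/-- The classical bias of the three-player XOR game with tensor `G`. -/
noncomputable def xorCBias3 {n₁ n₂ n₃ : ℕ}
    (G : Fin n₁ → Fin n₂ → Fin n₃ → ℝ) : ℝ :=
  sSup {r : ℝ | ∃ (a : Fin n₁ → ℝ) (b : Fin n₂ → ℝ) (c : Fin n₃ → ℝ),
    (∀ x, |a x| ≤ 1) ∧ (∀ y, |b y| ≤ 1) ∧ (∀ z, |c z| ≤ 1) ∧
    r = |∑ x, ∑ y, ∑ z, G x y z * a x * b y * c z|}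

/-- The entangled bias of the three-player XOR game with tensor `G`. -/
noncomputable def xorQBias3 {n₁ n₂ n₃ : ℕ}
    (G : Fin n₁ → Fin n₂ → Fin n₃ → ℝ) : ℝ :=
  sSup {r : ℝ | ∃ (d : ℕ) (ψ : Fin d × Fin d × Fin d → ℂ)
      (A : Fin n₁ → Matrix (Fin d) (Fin d) ℂ) (B : Fin n₂ → Matrix (Fin d) (Fin d) ℂ)
      (C : Fin n₃ → Matrix (Fin d) (Fin d) ℂ),
    1 ≤ d ∧ (∑ p, ‖ψ p‖ ^ 2 = 1) ∧
    (∀ x, IsContraction (A x)) ∧ (∀ y, IsContraction (B y)) ∧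
    (∀ z, IsContraction (C z)) ∧
    r = ‖∑ x, ∑ y, ∑ z, (G x y z : ℂ) *
          ∑ p : Fin d × Fin d × Fin d, ∑ q : Fin d × Fin d × Fin d,
            (starRingEnd ℂ) (ψ p) *
              (A x p.1 q.1 * B y p.2.1 q.2.1 * C z p.2.2 q.2.2) * ψ q‖}

open scoped Kronecker

theorem rad_exists (N : ℕ) : ∃ (Ω : Type) (_ : Fintype Ω) (f : Fin N → Ω → ℝ),
    0 < (Fintype.card Ω : ℝ) ∧
    (∀ u v : Fin N → ℝ, ∑ w, (∑ i, u i * f i w) * (∑ i, v i * f i w)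
      = Fintype.card Ω * ∑ i, u i * v i) ∧
    (∀ u : Fin N → ℝ, ∑ w, (∑ i, u i * f i w) ^ 4
      ≤ 3 * Fintype.card Ω * (∑ i, u i ^ 2) ^ 2) := by
  induction N with
  | zero => exact ⟨Unit, inferInstance, fun _ _ => 0, by simp, by simp, by simp⟩
  | succ N ih =>
    obtain ⟨Ω, hΩ, f, hc, h2, h4⟩ := ih
    refine ⟨Ω × Bool, inferInstance,
      Fin.cons (fun w => if w.2 then 1 else -1) (fun i w => f i w.1), ?_, ?_, ?_⟩
    · simp only [Fintype.card_prod, Fintype.card_bool]; push_cast; linarith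
    · intro u v
      have := h2 (fun i => u i.succ) (fun i => v i.succ)
      simp only [Fintype.sum_prod_type, Fin.sum_univ_succ, Fin.cons_zero, Fin.cons_succ,
        Fintype.sum_bool, Fintype.card_prod, Fintype.card_bool, if_true, Bool.false_eq_true, if_false]
      push_cast
      have e : ∀ w, (u 0 * 1 + ∑ i : Fin N, u i.succ * f i w) *
          (v 0 * 1 + ∑ i : Fin N, v i.succ * f i w) +
          (u 0 * -1 + ∑ i : Fin N, u i.succ * f i w) *
          (v 0 * -1 + ∑ i : Fin N, v i.succ * f i w)
          = 2 * ((∑ i : Fin N, u i.succ * f i w) * (∑ i : Fin N, v i.succ * f i w))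
            + 2 * (u 0 * v 0) := by
        intro w; simp; ring
      rw [Finset.sum_congr rfl (fun w _ => e w), Finset.sum_add_distrib, ← Finset.mul_sum, this]
      simp; ring
    · intro u
      have h2' := h2 (fun i => u i.succ) (fun i => u i.succ)
      have h4' := h4 (fun i => u i.succ)
      simp only [Fintype.sum_prod_type, Fin.sum_univ_succ, Fin.cons_zero, Fin.cons_succ,
        Fintype.sum_bool, Fintype.card_prod, Fintype.card_bool, if_true, Bool.false_eq_true, if_false]
      push_cast
      have e : ∀ w, (u 0 * 1 + ∑ i : Fin N, u i.succ * f i w) ^ 4 +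
          (u 0 * -1 + ∑ i : Fin N, u i.succ * f i w) ^ 4
          = 2 * (∑ i : Fin N, u i.succ * f i w) ^ 4
            + 12 * u 0 ^ 2 * ((∑ i : Fin N, u i.succ * f i w) * (∑ i : Fin N, u i.succ * f i w))
            + 2 * u 0 ^ 4 := by
        intro w; simp; ring
      rw [Finset.sum_congr rfl (fun w _ => e w), Finset.sum_add_distrib, Finset.sum_add_distrib,
        ← Finset.mul_sum, ← Finset.mul_sum, h2']
      have h3 : ∑ i : Fin N, u i.succ * u i.succ = ∑ i : Fin N, u i.succ ^ 2 := by
        simp only [pow_two]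
      rw [h3]
      simp only [Finset.sum_const, Finset.card_univ, nsmul_eq_mul]
      have : 0 ≤ (Fintype.card Ω : ℝ) * u 0 ^ 4 := by positivity
      nlinarith

/-- Hilbertian bound of a real matrix. -/
def HilbBd {n₁ n₂ : ℕ} (M : Fin n₁ → Fin n₂ → ℝ) (K : ℝ) : Prop :=
  ∀ (ι : Type) [Fintype ι] (u : Fin n₁ → ι → ℝ) (v : Fin n₂ → ι → ℝ),
    (∀ x, ∑ i, u x i ^ 2 ≤ 1) → (∀ y, ∑ i, v y i ^ 2 ≤ 1) →
    ∑ x, ∑ y, M x y * ∑ i, u x i * v y i ≤ K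

theorem HilbBd.scale {n₁ n₂ : ℕ} {M : Fin n₁ → Fin n₂ → ℝ} {K : ℝ} (h : HilbBd M K)
    {ι : Type} [Fintype ι] (u : Fin n₁ → ι → ℝ) (v : Fin n₂ → ι → ℝ) (s t : ℝ)
    (hs : 0 < s) (ht : 0 < t)
    (hu : ∀ x, ∑ i, u x i ^ 2 ≤ s ^ 2) (hv : ∀ y, ∑ i, v y i ^ 2 ≤ t ^ 2) :
    ∑ x, ∑ y, M x y * ∑ i, u x i * v y i ≤ K * (s * t) := by
  have key := h ι (fun x i => u x i / s) (fun y i => v y i / t)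
    (fun x => by
      simp only [div_pow]
      rw [← Finset.sum_div, div_le_one (by positivity)]; exact hu x)
    (fun y => by
      simp only [div_pow]
      rw [← Finset.sum_div, div_le_one (by positivity)]; exact hv y)
  have e : ∑ x, ∑ y, M x y * ∑ i, u x i / s * (v y i / t)
      = (∑ x, ∑ y, M x y * ∑ i, u x i * v y i) / (s * t) := by
    simp only [Finset.sum_div, Finset.mul_sum]
    refine Finset.sum_congr rfl fun x _ => Finset.sum_congr rfl fun y _ =>
      Finset.sum_congr rfl fun i _ => ?_
    field_simp
  rw [e, div_le_iff₀ (by positivity)] at key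
  exact key

/-- truncation at 2 -/
noncomputable def trunc2 (t : ℝ) : ℝ := max (-2) (min t 2)

theorem trunc2_abs (t : ℝ) : |trunc2 t / 2| ≤ 1 := by
  unfold trunc2
  rw [abs_le]
  constructor
  · have := le_max_left (-2) (min t 2); linarith
  · have : max (-2) (min t 2) ≤ 2 := max_le (by norm_num) (min_le_right _ _)
    linarith

theorem trunc2_sq (t : ℝ) : trunc2 t ^ 2 ≤ t ^ 2 := by
  unfold trunc2
  rcases le_total t 2 with h | h
  · rw [min_eq_left h]
    rcases le_total (-2) t with h' | h'
    · rw [max_eq_right h']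
    · rw [max_eq_left h']; nlinarith
  · rw [min_eq_right h, max_eq_right (by norm_num)]; nlinarith

theorem trunc2_tail (t : ℝ) : (t - trunc2 t) ^ 2 ≤ t ^ 4 / 64 := by
  unfold trunc2
  have e : t ^ 4 / 64 = (t ^ 2 / 8) ^ 2 := by ring
  rw [e]
  apply sq_le_sq'
  · rcases le_total t 2 with h | h
    · rw [min_eq_left h]
      rcases le_total (-2) t with h' | h'
      · rw [max_eq_right h']; nlinarith
      · rw [max_eq_left h']; nlinarith [sq_nonneg (t + 4)]
    · rw [min_eq_right h, max_eq_right (by norm_num)]; nlinarith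
  · rcases le_total t 2 with h | h
    · rw [min_eq_left h]
      rcases le_total (-2) t with h' | h'
      · rw [max_eq_right h']; nlinarith
      · rw [max_eq_left h']; nlinarith
    · rw [min_eq_right h, max_eq_right (by norm_num)]; nlinarith [sq_nonneg (t - 4)]

theorem HilbBd.step {n₁ n₂ : ℕ} {M : Fin n₁ → Fin n₂ → ℝ} {K β : ℝ} (h : HilbBd M K)
    (hM : ∀ (a : Fin n₁ → ℝ) (b : Fin n₂ → ℝ), (∀ x, |a x| ≤ 1) → (∀ y, |b y| ≤ 1) →
      ∑ x, ∑ y, M x y * (a x * b y) ≤ β) : HilbBd M (4 * β + K / 2) := by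
  intro ι _ u v hu hv
  obtain ⟨Ω, _, f0, hc, h20, h40⟩ := rad_exists (Fintype.card ι)
  let e := Fintype.equivFin ι
  obtain ⟨f, h2, h4⟩ : ∃ f : ι → Ω → ℝ,
      (∀ u v : ι → ℝ, ∑ w, (∑ i, u i * f i w) * (∑ i, v i * f i w)
        = Fintype.card Ω * ∑ i, u i * v i) ∧
      (∀ u : ι → ℝ, ∑ w, (∑ i, u i * f i w) ^ 4
        ≤ 3 * Fintype.card Ω * (∑ i, u i ^ 2) ^ 2) := by
    refine ⟨fun i => f0 (e i), fun u v => ?_, fun u => ?_⟩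
    · have := h20 (u ∘ e.symm) (v ∘ e.symm)
      simp only [← Equiv.sum_comp e, Function.comp, Equiv.symm_apply_apply] at this
      exact this
    · have := h40 (u ∘ e.symm)
      simp only [← Equiv.sum_comp e, Function.comp, Equiv.symm_apply_apply] at this
      exact this
  clear h20 h40
  set c : ℝ := (Fintype.card Ω : ℝ) with hcdef
  let s := Real.sqrt c
  have hs : 0 < s := Real.sqrt_pos.2 hc
  have hss : s ^ 2 = c := Real.sq_sqrt hc.le
  have b2 : ∀ u : ι → ℝ, ∑ i, u i ^ 2 ≤ 1 → ∑ w, (∑ i, u i * f i w) ^ 2 ≤ s ^ 2 := by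
    intro u hu
    have := h2 u u
    simp only [← pow_two] at this
    rw [this, hss]; nlinarith
  have b4 : ∀ u : ι → ℝ, ∑ i, u i ^ 2 ≤ 1 →
      ∑ w, (∑ i, u i * f i w - trunc2 (∑ i, u i * f i w)) ^ 2 ≤ (s / 4) ^ 2 := by
    intro u hu
    have h0 : 0 ≤ ∑ i, u i ^ 2 := Finset.sum_nonneg fun i _ => sq_nonneg _
    calc _ ≤ ∑ w, (∑ i, u i * f i w) ^ 4 / 64 := Finset.sum_le_sum fun w _ => trunc2_tail _
      _ = (∑ w, (∑ i, u i * f i w) ^ 4) / 64 := by rw [Finset.sum_div]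
      _ ≤ (3 * c * 1) / 64 := by
        have h1 : (∑ i, u i ^ 2) ^ 2 ≤ 1 := by nlinarith
        have := h4 u
        have h5 : 3 * c * (∑ i, u i ^ 2) ^ 2 ≤ 3 * c * 1 := by gcongr
        linarith
      _ ≤ _ := by rw [div_pow, hss]; linarith
  let F : Fin n₁ → Ω → ℝ := fun x w => ∑ i, u x i * f i w
  let H : Fin n₂ → Ω → ℝ := fun y w => ∑ i, v y i * f i w
  have t1 : ∑ x, ∑ y, M x y * ∑ w, trunc2 (F x w) * trunc2 (H y w) ≤ c * (4 * β) := by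
    have : ∑ x, ∑ y, M x y * ∑ w, trunc2 (F x w) * trunc2 (H y w)
        = ∑ w, 4 * ∑ x, ∑ y, M x y * ((trunc2 (F x w) / 2) * (trunc2 (H y w) / 2)) := by
      simp only [Finset.mul_sum]
      conv_rhs => rw [Finset.sum_comm]
      refine Finset.sum_congr rfl fun x _ => ?_
      rw [Finset.sum_comm]
      refine Finset.sum_congr rfl fun w _ => Finset.sum_congr rfl fun y _ => ?_
      ring
    rw [this]
    calc _ ≤ ∑ w : Ω, 4 * β := Finset.sum_le_sum fun w _ => by
            have := hM (fun x => trunc2 (F x w) / 2) (fun y => trunc2 (H y w) / 2)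
              (fun x => trunc2_abs _) (fun y => trunc2_abs _)
            linarith
      _ = _ := by simp [hcdef]
  have t2 := h.scale (fun x w => F x w - trunc2 (F x w)) H (s / 4) s (by positivity) hs
    (fun x => b4 _ (hu x)) (fun y => b2 _ (hv y))
  have t3 := h.scale (fun x w => trunc2 (F x w)) (fun y w => H y w - trunc2 (H y w)) s (s / 4)
    hs (by positivity)
    (fun x => (Finset.sum_le_sum fun w _ => trunc2_sq _).trans (b2 _ (hu x)))
    (fun y => b4 _ (hv y))
  have tot : c * ∑ x, ∑ y, M x y * ∑ i, u x i * v y i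
      = (∑ x, ∑ y, M x y * ∑ w, trunc2 (F x w) * trunc2 (H y w))
        + (∑ x, ∑ y, M x y * ∑ w, (F x w - trunc2 (F x w)) * H y w)
        + (∑ x, ∑ y, M x y * ∑ w, trunc2 (F x w) * (H y w - trunc2 (H y w))) := by
    rw [Finset.mul_sum, ← Finset.sum_add_distrib, ← Finset.sum_add_distrib]
    refine Finset.sum_congr rfl fun x _ => ?_
    rw [Finset.mul_sum, ← Finset.sum_add_distrib, ← Finset.sum_add_distrib]
    refine Finset.sum_congr rfl fun y _ => ?_
    rw [mul_left_comm, ← h2, ← mul_add, ← mul_add, ← Finset.sum_add_distrib,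
      ← Finset.sum_add_distrib]
    congr 1
    refine Finset.sum_congr rfl fun w _ => ?_
    simp only [F, H]; ring
  have e1 : K * (s / 4 * s) = c * (K / 4) := by rw [← hss]; ring
  have e2 : K * (s * (s / 4)) = c * (K / 4) := by rw [← hss]; ring
  rw [e1] at t2
  rw [e2] at t3
  have : c * ∑ x, ∑ y, M x y * ∑ i, u x i * v y i ≤ c * (4 * β + K / 2) := by
    rw [tot]; linarith
  exact le_of_mul_le_mul_left this hc

theorem hilb_init {n₁ n₂ : ℕ} (M : Fin n₁ → Fin n₂ → ℝ) :
    HilbBd M (∑ x, ∑ y, |M x y|) := by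
  intro ι _ u v hu hv
  refine Finset.sum_le_sum fun x _ => Finset.sum_le_sum fun y _ => ?_
  have : |∑ i, u x i * v y i| ≤ 1 := by
    have h := Finset.sum_mul_sq_le_sq_mul_sq Finset.univ (u x) (v y)
    have h0 : 0 ≤ ∑ i, v y i ^ 2 := Finset.sum_nonneg fun i _ => sq_nonneg _
    have h1 : 0 ≤ ∑ i, u x i ^ 2 := Finset.sum_nonneg fun i _ => sq_nonneg _
    rw [← sq_le_one_iff_abs_le_one]
    have := hu x; have := hv y
    nlinarith
  calc _ ≤ |M x y * ∑ i, u x i * v y i| := le_abs_self _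
    _ = |M x y| * |∑ i, u x i * v y i| := abs_mul _ _
    _ ≤ |M x y| * 1 := by gcongr
    _ = _ := mul_one _

/-- Grothendieck's inequality (real, constant 8). -/
theorem grothendieck {n₁ n₂ : ℕ} (M : Fin n₁ → Fin n₂ → ℝ) (β : ℝ)
    (hM : ∀ (a : Fin n₁ → ℝ) (b : Fin n₂ → ℝ), (∀ x, |a x| ≤ 1) → (∀ y, |b y| ≤ 1) →
      ∑ x, ∑ y, M x y * (a x * b y) ≤ β) : HilbBd M (8 * β) := by
  have hk : ∀ k : ℕ, HilbBd M (8 * β + ((∑ x, ∑ y, |M x y|) - 8 * β) * (1 / 2) ^ k) := by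
    intro k
    induction k with
    | zero => simpa using hilb_init M
    | succ k ih =>
      have := ih.step hM
      convert this using 1
      rw [pow_succ]; ring
  intro ι _ u v hu hv
  have lim : Filter.Tendsto
      (fun k : ℕ => 8 * β + ((∑ x, ∑ y, |M x y|) - 8 * β) * (1 / 2 : ℝ) ^ k)
      Filter.atTop (nhds (8 * β + ((∑ x, ∑ y, |M x y|) - 8 * β) * 0)) :=
    ((tendsto_pow_atTop_nhds_zero_of_lt_one (by norm_num) (by norm_num)).const_mul _).const_add _
  rw [mul_zero, add_zero] at lim
  exact ge_of_tendsto' lim fun k => hk k ι u v hu hv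

theorem signs_exist {E : Type*} [NormedAddCommGroup E] [InnerProductSpace ℂ E] (n : ℕ)
    (w : Fin n → E) : ∃ ε : Fin n → ℝ, (∀ z, |ε z| ≤ 1) ∧
      ∑ z, ‖w z‖ ^ 2 ≤ ‖∑ z, (ε z : ℂ) • w z‖ ^ 2 := by
  induction n with
  | zero => exact ⟨fun _ => 0, by simp, by simp⟩
  | succ n ih =>
    obtain ⟨ε, h1, h2⟩ := ih (fun z => w z.succ)
    have par := parallelogram_law_with_norm ℂ (∑ z, (ε z : ℂ) • w z.succ) (w 0)
    by_cases hc : ‖(∑ z, (ε z : ℂ) • w z.succ) - w 0‖ ≤ ‖(∑ z, (ε z : ℂ) • w z.succ) + w 0‖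
    · refine ⟨Fin.cons 1 ε, ?_, ?_⟩
      · intro z; refine Fin.cases ?_ (fun z => ?_) z <;> simp [h1]
      · simp only [Fin.sum_univ_succ, Fin.cons_zero, Fin.cons_succ, Complex.ofReal_one, one_smul]
        rw [add_comm (w 0)]
        nlinarith [norm_nonneg ((∑ z, (ε z : ℂ) • w z.succ) - w 0)]
    · push Not at hc
      refine ⟨Fin.cons (-1) ε, ?_, ?_⟩
      · intro z; refine Fin.cases ?_ (fun z => ?_) z <;> simp [h1]
      · simp only [Fin.sum_univ_succ, Fin.cons_zero, Fin.cons_succ, Complex.ofReal_neg,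
          Complex.ofReal_one, neg_smul, one_smul]
        rw [neg_add_eq_sub]
        nlinarith [norm_nonneg ((∑ z, (ε z : ℂ) • w z.succ) + w 0)]

theorem groth_complex {n₁ n₂ : ℕ} {M : Fin n₁ → Fin n₂ → ℝ} {K : ℝ} (h : HilbBd M K)
    {ι : Type} [Fintype ι] (u : Fin n₁ → EuclideanSpace ℂ ι) (v : Fin n₂ → EuclideanSpace ℂ ι)
    (s : ℝ) (hs : 0 < s) (hu : ∀ x, ‖u x‖ ≤ s) (hv : ∀ y, ‖v y‖ ≤ 1) :
    ∑ x, ∑ y, M x y * (inner ℂ (u x) (v y)).re ≤ K * s := by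
  have nrm : ∀ (p : EuclideanSpace ℂ ι) (t : ℝ), ‖p‖ ≤ t →
      ∑ i : ι ⊕ ι, (Sum.elim (fun i => (p i).re) (fun i => (p i).im) i) ^ 2 ≤ t ^ 2 := by
    intro p t hp
    have : ‖p‖ ^ 2 ≤ t ^ 2 := by gcongr
    rw [EuclideanSpace.norm_sq_eq] at this
    simp only [Fintype.sum_sum_type, Sum.elim_inl, Sum.elim_inr]
    rw [← Finset.sum_add_distrib]
    refine le_trans (le_of_eq ?_) this
    refine Finset.sum_congr rfl fun i _ => ?_
    rw [Complex.sq_norm, Complex.normSq_apply]; ring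
  have key := h.scale (ι := ι ⊕ ι)
    (fun x => Sum.elim (fun i => (u x i).re) (fun i => (u x i).im))
    (fun y => Sum.elim (fun i => (v y i).re) (fun i => (v y i).im)) s 1 hs one_pos
    (fun x => nrm _ _ (hu x)) (fun y => nrm _ _ (hv y))
  rw [mul_one] at key
  refine le_trans (le_of_eq ?_) key
  refine Finset.sum_congr rfl fun x _ => Finset.sum_congr rfl fun y _ => ?_
  congr 1
  simp only [Fintype.sum_sum_type, Sum.elim_inl, Sum.elim_inr, PiLp.inner_apply]
  rw [← Finset.sum_add_distrib, Complex.re_sum]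
  refine Finset.sum_congr rfl fun i _ => ?_
  simp [Complex.mul_re]; ring

theorem core {ι : Type} [Fintype ι] {n₁ n₂ n₃ : ℕ} (G : Fin n₁ → Fin n₂ → Fin n₃ → ℝ) (β : ℝ)
    (hβ : ∀ (a : Fin n₁ → ℝ) (b : Fin n₂ → ℝ) (c : Fin n₃ → ℝ), (∀ x, |a x| ≤ 1) →
      (∀ y, |b y| ≤ 1) → (∀ z, |c z| ≤ 1) → ∑ x, ∑ y, ∑ z, G x y z * a x * b y * c z ≤ β)
    (ψ : EuclideanSpace ℂ ι) (hψ : ‖ψ‖ ≤ 1)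
    (A : Fin n₁ → EuclideanSpace ℂ ι →L[ℂ] EuclideanSpace ℂ ι)
    (B : Fin n₂ → EuclideanSpace ℂ ι →L[ℂ] EuclideanSpace ℂ ι)
    (C : Fin n₃ → EuclideanSpace ℂ ι →L[ℂ] EuclideanSpace ℂ ι)
    (hA : ∀ x, ‖A x‖ ≤ 1) (hB : ∀ y, ‖B y‖ ≤ 1) (hC : ∀ z, ‖C z‖ ≤ 1) :
    ‖∑ x, ∑ y, ∑ z, (G x y z : ℂ) * inner ℂ ψ (C z (A x (B y ψ)))‖ ≤ 8 * √n₃ * β := by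
  have hβ0 : 0 ≤ β := by simpa using hβ 0 0 0 (by simp) (by simp) (by simp)
  let w : Fin n₃ → EuclideanSpace ℂ ι := fun z => ∑ x, ∑ y, (G x y z : ℂ) • A x (B y ψ)
  obtain ⟨ε, hε, hw⟩ := signs_exist n₃ w
  set W := ∑ z, (ε z : ℂ) • w z with hW
  have e1 : ∑ x, ∑ y, ∑ z, (G x y z : ℂ) * inner ℂ ψ (C z (A x (B y ψ)))
      = ∑ z, inner ℂ ψ (C z (w z)) := by
    simp only [w, map_sum, inner_sum, map_smul, inner_smul_right]
    rw [Finset.sum_comm (s := (Finset.univ : Finset (Fin n₃)))]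
    refine Finset.sum_congr rfl fun x _ => ?_
    rw [Finset.sum_comm]
  have e2 : ‖∑ z, inner ℂ ψ (C z (w z))‖ ≤ ∑ z, ‖w z‖ := by
    refine (norm_sum_le _ _).trans (Finset.sum_le_sum fun z _ => ?_)
    calc _ ≤ ‖ψ‖ * ‖C z (w z)‖ := norm_inner_le_norm _ _
      _ ≤ 1 * (1 * ‖w z‖) := by
        gcongr
        exact (C z).le_of_opNorm_le (hC z) _
      _ = _ := by ring
  have e3 : ∑ z, ‖w z‖ ≤ √n₃ * ‖W‖ := by
    have := sq_sum_le_card_mul_sum_sq (s := (Finset.univ : Finset (Fin n₃))) (f := fun z => ‖w z‖)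
    simp only [Finset.card_univ, Fintype.card_fin] at this
    refine (pow_le_pow_iff_left₀ (by positivity) (by positivity) two_ne_zero).1 ?_
    rw [mul_pow, Real.sq_sqrt (by positivity)]
    exact this.trans (by gcongr)
  have e4 : ‖W‖ ≤ 8 * β := by
    by_cases h0 : ‖W‖ = 0
    · rw [h0]; positivity
    have hpos : 0 < ‖W‖ := lt_of_le_of_ne (norm_nonneg _) (Ne.symm h0)
    let M : Fin n₁ → Fin n₂ → ℝ := fun x y => ∑ z, ε z * G x y z
    have hG : HilbBd M (8 * β) := by
      apply grothendieck
      intro a b ha hb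
      refine le_trans (le_of_eq ?_) (hβ a b ε ha hb hε)
      refine Finset.sum_congr rfl fun x _ => Finset.sum_congr rfl fun y _ => ?_
      simp only [M, Finset.sum_mul]
      refine Finset.sum_congr rfl fun z _ => ?_
      ring
    have key := groth_complex hG (fun x => ContinuousLinearMap.adjoint (A x) W) (fun y => B y ψ)
      ‖W‖ hpos (fun x => by
        have h1 : ‖ContinuousLinearMap.adjoint (A x)‖ ≤ 1 := by
          rw [LinearIsometryEquiv.norm_map]; exact hA x
        have := (ContinuousLinearMap.adjoint (A x)).le_of_opNorm_le h1 W
        simpa using this)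
      (fun y => by
        have := (B y).le_of_opNorm_le (hB y) ψ
        linarith)
    have e5 : W = ∑ x, ∑ y, (M x y : ℂ) • A x (B y ψ) := by
      simp only [hW, w, M, Finset.smul_sum, Complex.ofReal_sum, Finset.sum_smul]
      rw [Finset.sum_comm]
      refine Finset.sum_congr rfl fun x _ => ?_
      rw [Finset.sum_comm]
      refine Finset.sum_congr rfl fun y _ => Finset.sum_congr rfl fun z _ => ?_
      rw [smul_smul]; push_cast; rfl
    have e6 : ‖W‖ ^ 2 = ∑ x, ∑ y, M x y * (inner ℂ (ContinuousLinearMap.adjoint (A x) W) (B y ψ)).re := by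
      have : ‖W‖ ^ 2 = (inner ℂ W W).re := (inner_self_eq_norm_sq (𝕜 := ℂ) W).symm
      rw [this]
      conv_lhs => rw [e5]
      rw [← e5]
      conv_lhs => rw [e5, inner_sum, ← e5]
      rw [Complex.re_sum]
      refine Finset.sum_congr rfl fun x _ => ?_
      rw [inner_sum, Complex.re_sum]
      refine Finset.sum_congr rfl fun y _ => ?_
      rw [inner_smul_right, ContinuousLinearMap.adjoint_inner_left, Complex.re_ofReal_mul]
    rw [← e6, pow_two] at key
    exact le_of_mul_le_mul_right key hpos
  rw [e1]
  calc _ ≤ √n₃ * ‖W‖ := e2.trans e3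
    _ ≤ √n₃ * (8 * β) := by gcongr
    _ = _ := by ring

/-- contraction over general index -/
def IsC {ι : Type} [Fintype ι] (A : Matrix ι ι ℂ) : Prop :=
  ∀ v : ι → ℂ, ∑ i, ‖A.mulVec v i‖ ^ 2 ≤ ∑ i, ‖v i‖ ^ 2

theorem IsC.kron_one {ι κ : Type} [Fintype ι] [Fintype κ] [DecidableEq κ] {A : Matrix ι ι ℂ}
    (h : IsC A) : IsC (A ⊗ₖ (1 : Matrix κ κ ℂ)) := by
  intro v
  rw [Fintype.sum_prod_type_right, Fintype.sum_prod_type_right]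
  refine Finset.sum_le_sum fun k _ => ?_
  refine le_trans (le_of_eq ?_) (h (fun i => v (i, k)))
  refine Finset.sum_congr rfl fun i _ => ?_
  congr 2
  simp [Matrix.mulVec, dotProduct, Fintype.sum_prod_type, Matrix.kroneckerMap_apply,
    Matrix.one_apply]

theorem IsC.one_kron {ι κ : Type} [Fintype ι] [Fintype κ] [DecidableEq κ] {A : Matrix ι ι ℂ}
    (h : IsC A) : IsC ((1 : Matrix κ κ ℂ) ⊗ₖ A) := by
  intro v
  rw [Fintype.sum_prod_type, Fintype.sum_prod_type]
  refine Finset.sum_le_sum fun k _ => ?_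
  refine le_trans (le_of_eq ?_) (h (fun i => v (k, i)))
  refine Finset.sum_congr rfl fun i _ => ?_
  congr 2
  simp [Matrix.mulVec, dotProduct, Fintype.sum_prod_type_right, Matrix.kroneckerMap_apply,
    Matrix.one_apply]

theorem IsC.norm_le {ι : Type} [Fintype ι] [DecidableEq ι] {A : Matrix ι ι ℂ} (h : IsC A) :
    ‖Matrix.toEuclideanCLM (n := ι) (𝕜 := ℂ) A‖ ≤ 1 := by
  refine ContinuousLinearMap.opNorm_le_bound _ zero_le_one fun v => ?_
  rw [one_mul]
  refine (pow_le_pow_iff_left₀ (norm_nonneg _) (norm_nonneg _) two_ne_zero).1 ?_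
  rw [EuclideanSpace.norm_sq_eq, EuclideanSpace.norm_sq_eq]
  exact h v.ofLp

theorem bias_bdd {n₁ n₂ n₃ : ℕ} (G : Fin n₁ → Fin n₂ → Fin n₃ → ℝ)
    (a : Fin n₁ → ℝ) (b : Fin n₂ → ℝ) (c : Fin n₃ → ℝ) (ha : ∀ x, |a x| ≤ 1)
    (hb : ∀ y, |b y| ≤ 1) (hc : ∀ z, |c z| ≤ 1) :
    ∑ x, ∑ y, ∑ z, G x y z * a x * b y * c z ≤ xorCBias3 G := by
  refine (le_abs_self _).trans (le_csSup ?_ ⟨a, b, c, ha, hb, hc, rfl⟩)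
  refine ⟨∑ x, ∑ y, ∑ z, |G x y z|, ?_⟩
  rintro r ⟨a, b, c, ha, hb, hc, rfl⟩
  refine (Finset.abs_sum_le_sum_abs _ _).trans (Finset.sum_le_sum fun x _ => ?_)
  refine (Finset.abs_sum_le_sum_abs _ _).trans (Finset.sum_le_sum fun y _ => ?_)
  refine (Finset.abs_sum_le_sum_abs _ _).trans (Finset.sum_le_sum fun z _ => ?_)
  rw [abs_mul, abs_mul, abs_mul]
  calc _ ≤ |G x y z| * 1 * 1 * 1 := by
        gcongr
        · exact ha x
        · exact hb y
        · exact hc z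
    _ = _ := by ring

/-- upper bound on violations for three-player XOR games: there is a
universal `C > 0` with `β*(Ĝ) ≤ C √(min(n₁,n₂,n₃)) β(Ĝ)` for every real tensor `Ĝ`. -/
theorem stmt7 :
    ∃ C : ℝ, 0 < C ∧
      ∀ (n₁ n₂ n₃ : ℕ), 1 ≤ n₁ → 1 ≤ n₂ → 1 ≤ n₃ →
        ∀ G : Fin n₁ → Fin n₂ → Fin n₃ → ℝ,
          xorQBias3 G ≤ C * Real.sqrt (min n₁ (min n₂ n₃)) * xorCBias3 G := by
  refine ⟨8, by norm_num, ?_⟩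
  intro n₁ n₂ n₃ _ _ _ G
  have hb := bias_bdd G
  have hb0 : 0 ≤ xorCBias3 G := by simpa using hb 0 0 0 (by simp) (by simp) (by simp)
  refine Real.sSup_le ?_ (by positivity)
  rintro r ⟨d, ψ, A, B, C, hd, hψ, hA, hB, hC, rfl⟩
  let T := Matrix.toEuclideanCLM (n := Fin d × Fin d × Fin d) (𝕜 := ℂ)
  let A' : Fin n₁ → Matrix (Fin d × Fin d × Fin d) (Fin d × Fin d × Fin d) ℂ :=
    fun x => A x ⊗ₖ (1 : Matrix (Fin d × Fin d) (Fin d × Fin d) ℂ)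
  let B' : Fin n₂ → Matrix (Fin d × Fin d × Fin d) (Fin d × Fin d × Fin d) ℂ :=
    fun y => (1 : Matrix (Fin d) (Fin d) ℂ) ⊗ₖ (B y ⊗ₖ (1 : Matrix (Fin d) (Fin d) ℂ))
  let C' : Fin n₃ → Matrix (Fin d × Fin d × Fin d) (Fin d × Fin d × Fin d) ℂ :=
    fun z => (1 : Matrix (Fin d) (Fin d) ℂ) ⊗ₖ ((1 : Matrix (Fin d) (Fin d) ℂ) ⊗ₖ C z)
  have hA' : ∀ x, ‖T (A' x)‖ ≤ 1 := fun x => IsC.norm_le (IsC.kron_one (hA x))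
  have hB' : ∀ y, ‖T (B' y)‖ ≤ 1 := fun y => IsC.norm_le (IsC.one_kron (IsC.kron_one (hB y)))
  have hC' : ∀ z, ‖T (C' z)‖ ≤ 1 := fun z => IsC.norm_le (IsC.one_kron (IsC.one_kron (hC z)))
  let φ : EuclideanSpace ℂ (Fin d × Fin d × Fin d) := WithLp.toLp 2 ψ
  have hφ : ‖φ‖ ≤ 1 := by
    refine (pow_le_pow_iff_left₀ (norm_nonneg _) zero_le_one two_ne_zero).1 ?_
    rw [EuclideanSpace.norm_sq_eq, one_pow]
    exact hψ.le
  have val : ∀ x y z (N : Matrix (Fin d × Fin d × Fin d) (Fin d × Fin d × Fin d) ℂ),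
      N = A x ⊗ₖ (B y ⊗ₖ C z) →
      ∑ p : Fin d × Fin d × Fin d, ∑ q : Fin d × Fin d × Fin d,
            (starRingEnd ℂ) (ψ p) *
              (A x p.1 q.1 * B y p.2.1 q.2.1 * C z p.2.2 q.2.2) * ψ q
        = inner ℂ φ (T N φ) := by
    rintro x y z N rfl
    rw [PiLp.inner_apply]
    refine Finset.sum_congr rfl fun p _ => ?_
    have : (T (A x ⊗ₖ (B y ⊗ₖ C z)) φ) p = ∑ q, (A x ⊗ₖ (B y ⊗ₖ C z)) p q * ψ q := rfl
    rw [this, RCLike.inner_apply, mul_comm, Finset.mul_sum]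
    refine Finset.sum_congr rfl fun q _ => ?_
    simp only [Matrix.kroneckerMap_apply, φ]
    ring
  have v1 : ∀ x y z, C' z * (A' x * B' y) = A x ⊗ₖ (B y ⊗ₖ C z) := by
    intro x y z
    simp only [A', B', C', ← Matrix.mul_kronecker_mul, one_mul, mul_one]
  have v2 : ∀ x y z, B' y * (A' x * C' z) = A x ⊗ₖ (B y ⊗ₖ C z) := by
    intro x y z
    simp only [A', B', C', ← Matrix.mul_kronecker_mul, one_mul, mul_one]
  have v3 : ∀ x y z, A' x * (B' y * C' z) = A x ⊗ₖ (B y ⊗ₖ C z) := by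
    intro x y z
    simp only [A', B', C', ← Matrix.mul_kronecker_mul, one_mul, mul_one]
  have c3 := core G _ hb φ hφ (fun x => T (A' x)) (fun y => T (B' y)) (fun z => T (C' z)) hA' hB' hC'
  have c2 := core (fun x z y => G x y z) (xorCBias3 G) (fun a c b ha hc hb' => by
      refine le_trans (le_of_eq ?_) (hb a b c ha hb' hc)
      refine Finset.sum_congr rfl fun x _ => ?_
      rw [Finset.sum_comm]
      refine Finset.sum_congr rfl fun y _ => Finset.sum_congr rfl fun z _ => ?_
      ring) φ hφ
    (fun x => T (A' x)) (fun z => T (C' z)) (fun y => T (B' y)) hA' hC' hB'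
  have c1 := core (fun y z x => G x y z) (xorCBias3 G) (fun b c a hb' hc ha => by
      refine le_trans (le_of_eq ?_) (hb a b c ha hb' hc)
      conv_rhs => rw [Finset.sum_comm]
      refine Finset.sum_congr rfl fun y _ => ?_
      rw [Finset.sum_comm]
      refine Finset.sum_congr rfl fun x _ => Finset.sum_congr rfl fun z _ => ?_
      ring) φ hφ
    (fun y => T (B' y)) (fun z => T (C' z)) (fun x => T (A' x)) hB' hC' hA'
  set R := ∑ x, ∑ y, ∑ z, (G x y z : ℂ) *
          ∑ p : Fin d × Fin d × Fin d, ∑ q : Fin d × Fin d × Fin d,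
            (starRingEnd ℂ) (ψ p) *
              (A x p.1 q.1 * B y p.2.1 q.2.1 * C z p.2.2 q.2.2) * ψ q with hR
  have mulT : ∀ (X Y Z : Matrix (Fin d × Fin d × Fin d) (Fin d × Fin d × Fin d) ℂ),
      T X (T Y (T Z φ)) = T (X * (Y * Z)) φ := by
    intro X Y Z
    rw [map_mul, map_mul]; rfl
  have d3 : ‖R‖ ≤ 8 * √n₃ * xorCBias3 G := by
    refine le_trans (le_of_eq (congrArg _ ?_)) c3
    refine Finset.sum_congr rfl fun x _ => Finset.sum_congr rfl fun y _ =>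
      Finset.sum_congr rfl fun z _ => ?_
    rw [mulT, val x y z _ (v1 x y z)]
  have d2 : ‖R‖ ≤ 8 * √n₂ * xorCBias3 G := by
    refine le_trans (le_of_eq (congrArg _ ?_)) c2
    refine Finset.sum_congr rfl fun x _ => ?_
    rw [Finset.sum_comm]
    refine Finset.sum_congr rfl fun y _ => Finset.sum_congr rfl fun z _ => ?_
    rw [mulT, val x _ _ _ (v2 x _ _)]
  have d1 : ‖R‖ ≤ 8 * √n₁ * xorCBias3 G := by
    refine le_trans (le_of_eq (congrArg _ ?_)) c1
    rw [hR, Finset.sum_comm]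
    refine Finset.sum_congr rfl fun y _ => ?_
    rw [Finset.sum_comm]
    refine Finset.sum_congr rfl fun z _ => Finset.sum_congr rfl fun x _ => ?_
    rw [mulT, val x y z _ (v3 x y z)]
  rcases min_choice (n₁ : ℝ) (min (n₂ : ℝ) (n₃ : ℝ)) with h | h
  · rw [h]; exact d1
  · rw [h]
    rcases min_choice (n₂ : ℝ) (n₃ : ℝ) with h | h
    · rw [h]; exact d2
    · rw [h]; exact d3
end

section
/- (Dimension bound for Bell functionals.) For every bipartite Bell functional M with real coefficients and every integer d ≥ 1, the quantum value restricted to local dimension d satisfies ω*_d(M) ≤ 2d · ω(M). -/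
open scoped ComplexOrder

/-- The classical value of the Bell functional `M`: the best value of
`|Σ_{x,y} M_{x,y}^{f(x),g(y)}|` over deterministic strategies. -/
noncomputable def bellCVal {nx ny na nb : ℕ}
    (M : Fin nx → Fin ny → Fin na → Fin nb → ℝ) : ℝ :=
  sSup {r : ℝ | ∃ (f : Fin nx → Fin na) (g : Fin ny → Fin nb),
    r = |∑ x, ∑ y, M x y (f x) (g y)|}

/-- The quantum value of the Bell functional `M`, restricted to strategies using a
state of local dimension at most `d` (with arbitrary POVM measurements). -/
noncomputable def bellQValDim {nx ny na nb : ℕ} (d : ℕ)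
    (M : Fin nx → Fin ny → Fin na → Fin nb → ℝ) : ℝ :=
  sSup {r : ℝ | ∃ (k : ℕ) (ψ : Fin k × Fin k → ℂ)
      (A : Fin nx → Fin na → Matrix (Fin k) (Fin k) ℂ)
      (B : Fin ny → Fin nb → Matrix (Fin k) (Fin k) ℂ),
    1 ≤ k ∧ k ≤ d ∧ (∑ p, ‖ψ p‖ ^ 2 = 1) ∧
    (∀ x a, (A x a).PosSemidef) ∧ (∀ x, ∑ a, A x a = 1) ∧
    (∀ y b, (B y b).PosSemidef) ∧ (∀ y, ∑ b, B y b = 1) ∧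
    r = ‖(∑ x, ∑ y, ∑ a, ∑ b, (M x y a b : ℂ) *
          ∑ p : Fin k × Fin k, ∑ q : Fin k × Fin k,
            (starRingEnd ℂ) (ψ p) * (A x a p.1 q.1 * B y b p.2 q.2) * ψ q)‖}

lemma aux_bdd {nx ny na nb : ℕ} (M : Fin nx → Fin ny → Fin na → Fin nb → ℝ)
    (f : Fin nx → Fin na) (g : Fin ny → Fin nb) :
    |∑ x, ∑ y, M x y (f x) (g y)| ≤ bellCVal M := by
  apply le_csSup
  · have : {r : ℝ | ∃ (f : Fin nx → Fin na) (g : Fin ny → Fin nb),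
      r = |∑ x, ∑ y, M x y (f x) (g y)|} =
      Set.range (fun p : (Fin nx → Fin na) × (Fin ny → Fin nb) =>
        |∑ x, ∑ y, M x y (p.1 x) (p.2 y)|) := by
      ext r
      simp [Set.mem_range, Prod.exists, eq_comm]
    rw [this]
    exact (Set.finite_range _).bddAbove
  · exact ⟨f, g, rfl⟩

lemma aux_vertex {nx na : ℕ} (hne : Fin nx → Nonempty (Fin na))
    (c P : Fin nx → Fin na → ℝ) (α : ℝ)
    (hP : ∀ x a, 0 ≤ P x a) (hs : ∀ x, ∑ a, P x a = α) :
    ∃ f : Fin nx → Fin na, ∑ x, ∑ a, c x a * P x a ≤ α * ∑ x, c x (f x) := by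
  have h : ∀ x, ∃ a, ∑ a', c x a' * P x a' ≤ α * c x a := by
    intro x
    haveI := hne x
    obtain ⟨a, ha⟩ := Finite.exists_max (c x)
    refine ⟨a, ?_⟩
    rw [← hs x, Finset.sum_mul]
    refine Finset.sum_le_sum fun a' _ => ?_
    rw [mul_comm]
    exact mul_le_mul_of_nonneg_left (ha a') (hP x a')
  choose f hf using h
  refine ⟨f, ?_⟩
  rw [Finset.mul_sum]
  exact Finset.sum_le_sum fun x _ => hf x

lemma aux_one {nx ny na nb : ℕ} (M : Fin nx → Fin ny → Fin na → Fin nb → ℝ)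
    (hna : Fin nx → Nonempty (Fin na)) (hnb : Fin ny → Nonempty (Fin nb))
    (P : Fin nx → Fin na → ℝ) (Q : Fin ny → Fin nb → ℝ) (α β : ℝ) (hα : 0 ≤ α) (hβ : 0 ≤ β)
    (hP : ∀ x a, 0 ≤ P x a) (hs : ∀ x, ∑ a, P x a = α)
    (hQ : ∀ x a, 0 ≤ Q x a) (ht : ∀ x, ∑ a, Q x a = β) :
    ∃ (f : Fin nx → Fin na) (g : Fin ny → Fin nb), ∑ x, ∑ y, ∑ a, ∑ b, M x y a b * (P x a * Q y b) ≤
      α * β * ∑ x, ∑ y, M x y (f x) (g y) := by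
  obtain ⟨f, hf⟩ := aux_vertex hna (fun x a => ∑ y, ∑ b, M x y a b * Q y b) P α hP hs
  obtain ⟨g, hg⟩ := aux_vertex hnb (fun y b => ∑ x, M x y (f x) b) Q β hQ ht
  refine ⟨f, g, ?_⟩
  calc _ = ∑ x, ∑ a, (∑ y, ∑ b, M x y a b * Q y b) * P x a := by
        refine Finset.sum_congr rfl fun x _ => ?_
        rw [Finset.sum_comm]
        refine Finset.sum_congr rfl fun a _ => ?_
        simp only [Finset.sum_mul]
        refine Finset.sum_congr rfl fun y _ => Finset.sum_congr rfl fun b _ => ?_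
        ring
    _ ≤ _ := hf
    _ = α * ∑ y, ∑ b, (∑ x, M x y (f x) b) * Q y b := by
        congr 1
        rw [Finset.sum_comm]
        refine Finset.sum_congr rfl fun y _ => ?_
        rw [Finset.sum_comm]
        refine Finset.sum_congr rfl fun b _ => ?_
        rw [Finset.sum_mul]
    _ ≤ α * (β * ∑ y, ∑ x, M x y (f x) (g y)) := mul_le_mul_of_nonneg_left hg hα
    _ = _ := by rw [Finset.sum_comm, mul_assoc]

lemma aux_two {nx ny na nb : ℕ} (M : Fin nx → Fin ny → Fin na → Fin nb → ℝ)
    (hna : Fin nx → Nonempty (Fin na)) (hnb : Fin ny → Nonempty (Fin nb))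
    (P : Fin nx → Fin na → ℝ) (Q : Fin ny → Fin nb → ℝ) (α β : ℝ) (hα : 0 ≤ α) (hβ : 0 ≤ β)
    (hP : ∀ x a, 0 ≤ P x a) (hs : ∀ x, ∑ a, P x a = α)
    (hQ : ∀ x a, 0 ≤ Q x a) (ht : ∀ x, ∑ a, Q x a = β) :
    |∑ x, ∑ y, ∑ a, ∑ b, M x y a b * (P x a * Q y b)| ≤ α * β * bellCVal M := by
  have hab := mul_nonneg hα hβ
  rw [abs_le']
  constructor
  · obtain ⟨f, g, h⟩ := aux_one M hna hnb P Q α β hα hβ hP hs hQ ht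
    exact h.trans (mul_le_mul_of_nonneg_left ((le_abs_self _).trans (aux_bdd M f g)) hab)
  · obtain ⟨f, g, h⟩ := aux_one (fun x y a b => - M x y a b) hna hnb P Q α β hα hβ hP hs hQ ht
    simp only [neg_mul, Finset.sum_neg_distrib] at h
    exact h.trans (mul_le_mul_of_nonneg_left ((neg_le_abs _).trans (aux_bdd M f g)) hab)

/-- quadratic form -/
noncomputable def qf {k : ℕ} (A : Matrix (Fin k) (Fin k) ℂ) (u : Fin k → ℂ) : ℂ :=
  ∑ i, ∑ j, (starRingEnd ℂ) (u i) * A i j * u j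

lemma qf_eq {k : ℕ} (A : Matrix (Fin k) (Fin k) ℂ) (u : Fin k → ℂ) :
    qf A u = star u ⬝ᵥ (A.mulVec u) := by
  simp [qf, dotProduct, Matrix.mulVec, Finset.mul_sum, mul_assoc]

lemma qf_real {k : ℕ} (A : Matrix (Fin k) (Fin k) ℂ) (hA : A.PosSemidef) (u : Fin k → ℂ) :
    0 ≤ (qf A u).re ∧ qf A u = ((qf A u).re : ℂ) := by
  have h : 0 ≤ qf A u := by
    rw [qf_eq]; exact hA.dotProduct_mulVec_nonneg u
  rw [Complex.le_def] at h
  refine ⟨by simpa using h.1, ?_⟩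
  apply Complex.ext <;> simp
  simpa using h.2.symm

lemma qf_one {k : ℕ} (u : Fin k → ℂ) : qf 1 u = ((∑ i, ‖u i‖ ^ 2 : ℝ) : ℂ) := by
  simp only [qf, Matrix.one_apply]
  push_cast
  refine Finset.sum_congr rfl fun i _ => ?_
  simp [Complex.conj_mul']

lemma qf_sum {k n : ℕ} (A : Fin n → Matrix (Fin k) (Fin k) ℂ) (u : Fin k → ℂ) :
    qf (∑ a, A a) u = ∑ a, qf (A a) u := by
  simp only [qf_eq, Matrix.sum_mulVec, dotProduct_sum]

lemma aux_F {nx ny na nb k : ℕ} (M : Fin nx → Fin ny → Fin na → Fin nb → ℝ)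
    (hna : Fin nx → Nonempty (Fin na)) (hnb : Fin ny → Nonempty (Fin nb))
    (A : Fin nx → Fin na → Matrix (Fin k) (Fin k) ℂ)
    (B : Fin ny → Fin nb → Matrix (Fin k) (Fin k) ℂ)
    (hA : ∀ x a, (A x a).PosSemidef) (hA1 : ∀ x, ∑ a, A x a = 1)
    (hB : ∀ y b, (B y b).PosSemidef) (hB1 : ∀ y, ∑ b, B y b = 1) (u v : Fin k → ℂ) :
    ‖∑ x, ∑ y, ∑ a, ∑ b, (M x y a b : ℂ) * (qf (A x a) u * qf (B y b) v)‖ ≤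
      (∑ i, ‖u i‖ ^ 2) * (∑ i, ‖v i‖ ^ 2) * bellCVal M := by
  have h := aux_two M hna hnb (fun x a => (qf (A x a) u).re) (fun y b => (qf (B y b) v).re)
    (∑ i, ‖u i‖ ^ 2) (∑ i, ‖v i‖ ^ 2) (by positivity) (by positivity)
    (fun x a => (qf_real _ (hA x a) u).1)
    (fun x => by rw [← Complex.re_sum, ← qf_sum, hA1, qf_one, Complex.ofReal_re])
    (fun x a => (qf_real _ (hB x a) v).1)
    (fun x => by rw [← Complex.re_sum, ← qf_sum, hB1, qf_one, Complex.ofReal_re])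
  refine le_of_eq_of_le ?_ h
  rw [← Real.norm_eq_abs, ← Complex.norm_real]
  congr 1
  push_cast
  refine Finset.sum_congr rfl fun x _ => Finset.sum_congr rfl fun y _ =>
    Finset.sum_congr rfl fun a _ => Finset.sum_congr rfl fun b _ => ?_
  rw [← (qf_real _ (hA x a) u).2, ← (qf_real _ (hB y b) v).2]

/-- cubic phase -/
noncomputable def ph (a : ZMod 3) : ℂ := ZMod.stdAddChar (N := 3) a

lemma ph_conj (a : ZMod 3) : (starRingEnd ℂ) (ph a) = ph (-a) := by
  simp only [ph]
  rw [AddChar.map_neg_eq_conj]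

lemma ph_add (a b : ZMod 3) : ph (a + b) = ph a * ph b := by
  simp only [ph]
  rw [AddChar.map_add_eq_mul]

lemma ph_zero : ph 0 = 1 := by simp [ph]

lemma ph_ne {a : ZMod 3} (h : a ≠ 0) : ph a ≠ 1 := by
  intro h1
  apply h
  apply ZMod.injective_stdAddChar (N := 3)
  simpa [ph] using h1

lemma ph_sum {k : ℕ} (i m j l : Fin k) :
    ∑ s : Fin k → ZMod 3, ph (-s i + s m + s j - s l) =
      if (i = m ∧ j = l) ∨ (i = j ∧ m = l) then (Fintype.card (Fin k → ZMod 3) : ℂ) else 0 := by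
  split_ifs with h
  · have : ∀ s : Fin k → ZMod 3, ph (-s i + s m + s j - s l) = 1 := by
      intro s
      rw [← ph_zero]
      congr 1
      rcases h with ⟨rfl, rfl⟩ | ⟨rfl, rfl⟩ <;> ring
    simp [this]
  · have key : ∃ t : Fin k → ZMod 3, -t i + t m + t j - t l ≠ 0 := by
      by_cases him : i = m
      · subst him
        refine ⟨Pi.single j 1, ?_⟩
        have : l ≠ j := fun e => h (Or.inl ⟨rfl, e.symm⟩)
        simp [Pi.single_apply, this]
      · by_cases hij : i = j
        · subst hij
          refine ⟨Pi.single m 1, ?_⟩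
          have : l ≠ m := fun e => h (Or.inr ⟨rfl, e.symm⟩)
          simp [Pi.single_apply, this]
        · refine ⟨Pi.single i 1, ?_⟩
          simp only [Pi.single_apply, Ne.symm him, Ne.symm hij]
          by_cases hl : l = i <;> simp [hl] <;> decide
    obtain ⟨t, ht⟩ := key
    have e : ∑ s : Fin k → ZMod 3, ph (-s i + s m + s j - s l) =
        ph (-t i + t m + t j - t l) * ∑ s : Fin k → ZMod 3, ph (-s i + s m + s j - s l) := by
      rw [Finset.mul_sum]
      rw [← Equiv.sum_comp (Equiv.addLeft t)]
      refine Finset.sum_congr rfl fun s _ => ?_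
      rw [← ph_add]
      congr 1
      simp only [Equiv.coe_addLeft, Pi.add_apply]
      ring
    have h2 := ph_ne ht
    by_contra h3
    apply h2
    exact (mul_right_cancel₀ h3 ((one_mul _).trans e)).symm

/-- the Bob vector -/
noncomputable def vv {k : ℕ} (ψ : Fin k × Fin k → ℂ) (s : Fin k → ZMod 3) (m : Fin k) : ℂ :=
  ∑ j, ph (-s j) * ψ (j, m)

/-- sesquilinear entries -/
noncomputable def DD {k : ℕ} (ψ : Fin k × Fin k → ℂ) (B : Matrix (Fin k) (Fin k) ℂ)
    (j l : Fin k) : ℂ :=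
  ∑ p, ∑ q, (starRingEnd ℂ) (ψ (j, p)) * B p q * ψ (l, q)

lemma qf_u {k : ℕ} (A : Matrix (Fin k) (Fin k) ℂ) (s : Fin k → ZMod 3) :
    qf A (fun i => ph (s i)) = ∑ i, ∑ m, ph (-s i + s m) * A i m := by
  simp only [qf, ph_conj, ph_add]
  refine Finset.sum_congr rfl fun i _ => Finset.sum_congr rfl fun m _ => ?_
  ring

lemma qf_v {k : ℕ} (ψ : Fin k × Fin k → ℂ) (B : Matrix (Fin k) (Fin k) ℂ) (s : Fin k → ZMod 3) :
    qf B (vv ψ s) = ∑ j, ∑ l, ph (s j - s l) * DD ψ B j l := by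
  simp only [qf, vv, map_sum, map_mul, ph_conj, DD, sub_eq_add_neg, ph_add, neg_neg,
    Finset.mul_sum, Finset.sum_mul]
  calc _ = ∑ p, ∑ j, ∑ q, ∑ l, ph (s j) * (starRingEnd ℂ) (ψ (j, p)) * B p q *
        (ph (-s l) * ψ (l, q)) := by
        refine Finset.sum_congr rfl fun p _ => ?_
        symm
        rw [Finset.sum_comm]
        exact Finset.sum_congr rfl fun q _ => Finset.sum_comm
    _ = _ := by
        rw [Finset.sum_comm]
        refine Finset.sum_congr rfl fun j _ => ?_
        calc _ = ∑ p, ∑ l, ∑ q, ph (s j) * (starRingEnd ℂ) (ψ (j, p)) * B p q *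
              (ph (-s l) * ψ (l, q)) := Finset.sum_congr rfl fun p _ => Finset.sum_comm
          _ = _ := by
            rw [Finset.sum_comm]
            refine Finset.sum_congr rfl fun l _ => Finset.sum_congr rfl fun p _ =>
              Finset.sum_congr rfl fun q _ => ?_
            ring

lemma aux_lhs {k : ℕ} (ψ : Fin k × Fin k → ℂ) (A B : Matrix (Fin k) (Fin k) ℂ) :
    ∑ p : Fin k × Fin k, ∑ q : Fin k × Fin k,
      (starRingEnd ℂ) (ψ p) * (A p.1 q.1 * B p.2 q.2) * ψ q = ∑ i, ∑ m, A i m * DD ψ B i m := by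
  simp only [Fintype.sum_prod_type, DD, Finset.mul_sum]
  refine Finset.sum_congr rfl fun i _ => ?_
  rw [Finset.sum_comm]
  refine Finset.sum_congr rfl fun m _ => Finset.sum_congr rfl fun p _ =>
    Finset.sum_congr rfl fun q _ => ?_
  ring

lemma aux_comb {k : ℕ} (c : ℂ) (i m j l : Fin k) (X : ℂ) :
    (if (i = m ∧ j = l) ∨ (i = j ∧ m = l) then c else 0) * X =
      (if i = j then (if m = l then c * X else 0) else 0) +
      (if i = m then (if j = l then (if i = j then 0 else c * X) else 0) else 0) := by
  by_cases h1 : i = m <;> by_cases h2 : j = l <;> by_cases h3 : i = j <;>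
    by_cases h4 : m = l <;> simp_all

lemma aux_id {k : ℕ} (ψ : Fin k × Fin k → ℂ) (A B : Matrix (Fin k) (Fin k) ℂ) :
    ∑ s : Fin k → ZMod 3, qf A (fun i => ph (s i)) * qf B (vv ψ s) =
      (Fintype.card (Fin k → ZMod 3) : ℂ) *
      ((∑ i, ∑ m, A i m * DD ψ B i m) +
        ∑ i, ∑ j, if i = j then 0 else A i i * DD ψ B j j) := by
  calc _ = ∑ i, ∑ m, ∑ j, ∑ l, (∑ s : Fin k → ZMod 3, ph (-s i + s m + s j - s l)) *
        (A i m * DD ψ B j l) := by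
        simp only [qf_u, qf_v, Finset.sum_mul]
        rw [Finset.sum_comm]
        refine Finset.sum_congr rfl fun i _ => ?_
        rw [Finset.sum_comm]
        refine Finset.sum_congr rfl fun m _ => ?_
        simp only [Finset.mul_sum]
        rw [Finset.sum_comm]
        refine Finset.sum_congr rfl fun j _ => ?_
        rw [Finset.sum_comm]
        refine Finset.sum_congr rfl fun l _ => ?_
        refine Finset.sum_congr rfl fun s _ => ?_
        rw [add_sub_assoc, ph_add (-s i + s m)]
        ring
    _ = _ := by
        simp only [ph_sum, aux_comb, Finset.sum_add_distrib, mul_add]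
        congr 1
        · simp [Finset.mul_sum]
        · simp [Finset.mul_sum]

lemma qf_single {k : ℕ} (A : Matrix (Fin k) (Fin k) ℂ) (i : Fin k) :
    qf A (Pi.single i 1) = A i i := by
  simp [qf_eq]

lemma DD_diag {k : ℕ} (ψ : Fin k × Fin k → ℂ) (B : Matrix (Fin k) (Fin k) ℂ) (j : Fin k) :
    DD ψ B j j = qf B (fun p => ψ (j, p)) := rfl

lemma main_id {k : ℕ} (ψ : Fin k × Fin k → ℂ) (A B : Matrix (Fin k) (Fin k) ℂ) :
    ∑ p : Fin k × Fin k, ∑ q : Fin k × Fin k,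
      (starRingEnd ℂ) (ψ p) * (A p.1 q.1 * B p.2 q.2) * ψ q =
    (Fintype.card (Fin k → ZMod 3) : ℂ)⁻¹ *
      (∑ s : Fin k → ZMod 3, qf A (fun i => ph (s i)) * qf B (vv ψ s)) -
      ∑ i, ∑ j, if i = j then 0 else qf A (Pi.single i 1) * qf B (fun p => ψ (j, p)) := by
  have hN : (Fintype.card (Fin k → ZMod 3) : ℂ) ≠ 0 := by
    exact_mod_cast Fintype.card_ne_zero
  rw [aux_lhs, aux_id, inv_mul_cancel_left₀ hN]
  simp only [qf_single, DD_diag]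
  ring

lemma aux_w {k : ℕ} (w : Fin k → ℝ) :
    ∑ i : Fin k, ∑ j, (if i = j then 0 else w j) = (k - 1) * ∑ j, w j := by
  have : ∀ i : Fin k, ∑ j, (if i = j then 0 else w j) = (∑ j, w j) - w i := by
    intro i
    have h : ∀ j, (if i = j then 0 else w j) = w j - if i = j then w j else 0 := by
      intro j; split_ifs <;> simp
    simp [h, Finset.sum_sub_distrib]
  simp [this, Finset.sum_sub_distrib]
  ring

theorem stmt17 {nx ny na nb : ℕ}
    (M : Fin nx → Fin ny → Fin na → Fin nb → ℝ)
    (d : ℕ) (hd : 1 ≤ d) :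
    bellQValDim d M ≤ (2 * d) * bellCVal M := by
  have hC : 0 ≤ bellCVal M := by
    apply Real.sSup_nonneg
    rintro r ⟨f, g, rfl⟩
    positivity
  apply Real.sSup_le _ (by positivity)
  rintro r ⟨k, ψ, A, B, hk, hkd, hψ, hA, hA1, hB, hB1, rfl⟩
  have hna : Fin nx → Nonempty (Fin na) := by
    intro x
    by_contra h
    rw [not_nonempty_iff] at h
    have := congrFun (congrFun (hA1 x) ⟨0, hk⟩) ⟨0, hk⟩
    simp at this
  have hnb : Fin ny → Nonempty (Fin nb) := by
    intro x
    by_contra h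
    rw [not_nonempty_iff] at h
    have := congrFun (congrFun (hB1 x) ⟨0, hk⟩) ⟨0, hk⟩
    simp at this
  have hF := aux_F M hna hnb A B hA hA1 hB hB1
  set F : (Fin k → ℂ) → (Fin k → ℂ) → ℂ := fun u v =>
    ∑ x, ∑ y, ∑ a, ∑ b, (M x y a b : ℂ) * (qf (A x a) u * qf (B y b) v) with hFd
  set N : ℝ := (Fintype.card (Fin k → ZMod 3) : ℝ) with hN
  have hN0 : 0 < N := by
    rw [hN]; exact_mod_cast Fintype.card_pos
  set w : Fin k → ℝ := fun j => ∑ p, ‖ψ (j, p)‖ ^ 2 with hw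
  have hw1 : ∑ j, w j = 1 := by
    rw [← hψ, Fintype.sum_prod_type]
  have hval : (∑ x, ∑ y, ∑ a, ∑ b, (M x y a b : ℂ) *
          ∑ p : Fin k × Fin k, ∑ q : Fin k × Fin k,
            (starRingEnd ℂ) (ψ p) * (A x a p.1 q.1 * B y b p.2 q.2) * ψ q) =
      (N : ℂ)⁻¹ * (∑ s : Fin k → ZMod 3, F (fun i => ph (s i)) (vv ψ s)) -
      ∑ i, ∑ j, if i = j then 0 else F (Pi.single i 1) (fun p => ψ (j, p)) := by
    have e1 : ∀ i j : Fin k, (if i = j then 0 else F (Pi.single i 1) (fun p => ψ (j, p))) =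
        ∑ x, ∑ y, ∑ a, ∑ b, (M x y a b : ℂ) * (if i = j then 0 else
          qf (A x a) (Pi.single i 1) * qf (B y b) (fun p => ψ (j, p))) := by
      intro i j
      split_ifs <;> simp [hFd]
    simp only [main_id, e1]
    simp only [hFd, mul_sub, Finset.sum_sub_distrib]
    have sw : ∀ {ι : Type} [Fintype ι] (G : ι → Fin nx → Fin ny → Fin na → Fin nb → ℂ),
        ∑ i, ∑ x, ∑ y, ∑ a, ∑ b, G i x y a b = ∑ x, ∑ y, ∑ a, ∑ b, ∑ i, G i x y a b := by
      intro ι _ G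
      rw [Finset.sum_comm]
      refine Finset.sum_congr rfl fun x _ => ?_
      rw [Finset.sum_comm]
      refine Finset.sum_congr rfl fun y _ => ?_
      rw [Finset.sum_comm]
      refine Finset.sum_congr rfl fun a _ => ?_
      rw [Finset.sum_comm]
    congr 1
    · rw [sw]
      simp only [Finset.mul_sum]
      refine Finset.sum_congr rfl fun x _ => Finset.sum_congr rfl fun y _ =>
        Finset.sum_congr rfl fun a _ => Finset.sum_congr rfl fun b _ =>
        Finset.sum_congr rfl fun s _ => ?_
      simp only [hN, Complex.ofReal_natCast]
      ring
    · simp only [sw]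
      simp only [Finset.mul_sum]
  have havg : N⁻¹ * ∑ s : Fin k → ZMod 3, (∑ i, ‖ph (s i)‖ ^ 2) * (∑ i, ‖vv ψ s i‖ ^ 2) = k := by
    have h := main_id ψ 1 1
    have hl : ∑ p : Fin k × Fin k, ∑ q : Fin k × Fin k,
      (starRingEnd ℂ) (ψ p) * ((1 : Matrix (Fin k) (Fin k) ℂ) p.1 q.1 *
        (1 : Matrix (Fin k) (Fin k) ℂ) p.2 q.2) * ψ q = ((∑ j, w j : ℝ) : ℂ) := by
      rw [aux_lhs]
      simp only [Matrix.one_apply, ite_mul, one_mul, zero_mul, Finset.sum_ite_eq,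
        Finset.mem_univ, if_true]
      push_cast
      refine Finset.sum_congr rfl fun j _ => ?_
      rw [DD_diag, qf_one]
    rw [hl] at h
    simp only [qf_one] at h
    have hs : ∀ i : Fin k, ∑ p, ‖(Pi.single i 1 : Fin k → ℂ) p‖ ^ 2 = 1 := by
      intro i
      rw [Finset.sum_eq_single i] <;> simp +contextual [Pi.single_apply]
    simp only [hs] at h
    have h' : (∑ j, w j) = N⁻¹ * (∑ s : Fin k → ZMod 3, (∑ i, ‖ph (s i)‖ ^ 2) *
        (∑ i, ‖vv ψ s i‖ ^ 2)) - ∑ i : Fin k, ∑ j, (if i = j then 0 else w j) := by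
      apply Complex.ofReal_injective
      rw [h]
      push_cast
      congr 1
      refine Finset.sum_congr rfl fun i _ => Finset.sum_congr rfl fun j _ => ?_
      split_ifs <;> simp [hw]
    rw [aux_w, hw1] at h'
    linarith
  rw [hval]
  calc _ ≤ N⁻¹ * (∑ s : Fin k → ZMod 3, (∑ i, ‖ph (s i)‖ ^ 2) * (∑ i, ‖vv ψ s i‖ ^ 2) *
          bellCVal M) + ∑ i : Fin k, ∑ j, (if i = j then 0 else w j) * bellCVal M := by
        refine (norm_sub_le _ _).trans (add_le_add ?_ ?_)
        · rw [norm_mul, norm_inv, Complex.norm_real, Real.norm_eq_abs, abs_of_pos hN0]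
          refine mul_le_mul_of_nonneg_left ?_ (inv_nonneg.2 hN0.le)
          exact (norm_sum_le _ _).trans (Finset.sum_le_sum fun s _ => hF _ _)
        · refine (norm_sum_le _ _).trans (Finset.sum_le_sum fun i _ => ?_)
          refine (norm_sum_le _ _).trans (Finset.sum_le_sum fun j _ => ?_)
          split_ifs
          · simp
          · refine (hF _ _).trans (le_of_eq ?_)
            rw [Finset.sum_eq_single i] <;> simp +contextual [Pi.single_apply, hw]
    _ = (2 * k - 1) * bellCVal M := by
        simp only [← Finset.sum_mul]
        rw [← mul_assoc, havg, aux_w, hw1]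
        ring
    _ ≤ _ := by
        refine mul_le_mul_of_nonneg_right ?_ hC
        have : (k : ℝ) ≤ d := by exact_mod_cast hkd
        linarith
end
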